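/- Let D ≥ 1, k ≥ 1 and b ≥ 0 be integers, and define f : ℕ³ → ℕ by f(D,b,k) = 1 whenever k = 1 or b = 0, and f(D,b,k) = f(D,b,k-1) + (D-1)·f(D,b-1,k-1) whenever k ≥ 2 and b ≥ 1. Let T be a finite rooted tree whose maximum degree (as a graph) is at most D and whose binary-minor depth b(T) is at most b. If T has more than f(D,b,k) leaves, then T contains a root-to-leaf path on which at least k vertices have at least two children. -/

import Mathlib

/-- A finite rooted tree: a node together with a finite list of child subtrees. -/
inductive RTree : Type where
  | node : List RTree → RTree

namespace RTree

/-- The number of children of the root of a tree. -/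
def numChildren : RTree → ℕ
  | .node ts => ts.length

/-- The number of leaves of a tree (a single vertex is one leaf). -/
def leaves : RTree → ℕ
  | .node [] => 1
  | .node (t :: ts) => ((t :: ts).attach.map fun ⟨s, _⟩ => leaves s).sum

/-- Auxiliary: maximum degree over the vertices of a tree, where every vertex
(including the root of this subtree) is regarded as a non-root vertex, so that
its degree is its number of children plus one (for the edge to its parent). -/
def maxDegAux : RTree → ℕ
  | .node ts =>
    max (ts.length + 1) ((ts.attach.map fun ⟨s, _⟩ => maxDegAux s).foldr max 0)

/-- The maximum degree of a rooted tree seen as a graph: the degree of the root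
is its number of children, and the degree of any other vertex is its number of
children plus one. -/
def maxDegree : RTree → ℕ
  | .node ts =>
    max ts.length ((ts.attach.map fun ⟨s, _⟩ => maxDegAux s).foldr max 0)

/-- The binary-minor depth `b(T)`: the maximum depth of a rooted complete binary
tree appearing in `T` as a rooted minor.  Recursively, `b(T) = 0` for a single
vertex, and otherwise `b(T) = max (M₁) (M₂ + 1)` where `M₁ ≥ M₂` are the two
largest values of `b` over the children subtrees of the root (with `M₂ = 0` if
the root has only one child). -/
def bDepth : RTree → ℕ
  | .node [] => 0
  | .node (t :: ts) =>
    let l := (t :: ts).attach.map fun ⟨s, _⟩ => bDepth s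
    let M₁ := l.foldr max 0
    let M₂ := (l.erase M₁).foldr max 0
    max M₁ (M₂ + 1)

/-- `RootLeafPath T p` holds when `p` is the sequence of vertices (identified
with the subtrees rooted at them) of a path from the root of `T` to a leaf
of `T`. -/
inductive RootLeafPath : RTree → List RTree → Prop where
  | leaf : RootLeafPath (.node []) [.node []]
  | step {ts : List RTree} {t : RTree} {p : List RTree} :
      t ∈ ts → RootLeafPath t p → RootLeafPath (.node ts) (.node ts :: p)

end RTree

/-- The function `f(D, b, k)` of Lemma 3.6: `f(D,b,k) = 1` if `k = 1` or
`b = 0`, and `f(D,b,k) = f(D,b,k-1) + (D-1)·f(D,b-1,k-1)` if `k ≥ 2`, `b ≥ 1`. -/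
def fDBK (D : ℕ) : ℕ → ℕ → ℕ
  | _, 0 => 1
  | 0, _ => 1
  | _, 1 => 1
  | b + 1, k + 2 => fDBK D (b + 1) (k + 1) + (D - 1) * fDBK D b (k + 1)

namespace RTree

theorem leaves_node {ts : List RTree} (h : ts ≠ []) :
    leaves (.node ts) = (ts.map leaves).sum := by
  cases ts with
  | nil => exact absurd rfl h
  | cons t ts => rw [leaves]; simp

theorem bDepth_node {ts : List RTree} (h : ts ≠ []) :
    bDepth (.node ts) = max ((ts.map bDepth).foldr max 0)
      (((ts.map bDepth).erase ((ts.map bDepth).foldr max 0)).foldr max 0 + 1) := by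
  cases ts with
  | nil => exact absurd rfl h
  | cons t ts =>
    rw [bDepth]
    simp only [List.map_subtype, List.unattach_attach]

theorem le_foldr_max {l : List ℕ} {a : ℕ} (h : a ∈ l) : a ≤ l.foldr max 0 := by
  induction l with
  | nil => simp at h
  | cons b l ih =>
    rcases List.mem_cons.1 h with rfl | h
    · simp
    · simpa using Or.inr (ih h)

theorem foldr_max_mem {l : List ℕ} (h : l ≠ []) : l.foldr max 0 ∈ l := by
  induction l with
  | nil => exact absurd rfl h
  | cons b l ih =>
    rcases eq_or_ne l [] with rfl | hl
    · simp
    · have := ih hl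
      rw [List.foldr_cons]
      rcases max_choice b (l.foldr max 0) with e | e <;> rw [e] <;> simp [this]

theorem length_le_maxDegree (ts : List RTree) : ts.length ≤ maxDegree (.node ts) := by
  rw [maxDegree]; exact le_max_left _ _

theorem maxDegree_le_maxDegAux (t : RTree) : maxDegree t ≤ maxDegAux t := by
  cases t with
  | node ts => rw [maxDegree, maxDegAux]; exact max_le_max (Nat.le_succ _) le_rfl

theorem maxDegree_le_of_mem {ts : List RTree} {t : RTree} (h : t ∈ ts) :
    maxDegree t ≤ maxDegree (.node ts) := by
  refine (maxDegree_le_maxDegAux t).trans ?_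
  rw [maxDegree]
  refine le_max_of_le_right (le_foldr_max ?_)
  simpa using ⟨t, h, rfl⟩

/-- All children but one have binary-minor depth smaller than that of the tree. -/
theorem exists_perm_cons_bDepth {ts : List RTree} (h : ts ≠ []) :
    ∃ t rest, ts.Perm (t :: rest) ∧ bDepth t ≤ bDepth (.node ts) ∧
      ∀ s ∈ rest, bDepth s + 1 ≤ bDepth (.node ts) := by
  obtain ⟨t, ht, e⟩ := List.mem_map.1
    (foldr_max_mem (l := ts.map bDepth) (by simpa using h))
  obtain ⟨l₁, l₂, rfl⟩ := List.append_of_mem ht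
  have hp : (l₁ ++ t :: l₂).Perm (t :: (l₁ ++ l₂)) := List.perm_middle
  refine ⟨t, l₁ ++ l₂, hp, ?_, fun s hs => ?_⟩
  · rw [bDepth_node h, ← e]; exact le_max_left _ _
  · rw [bDepth_node h, ← e]
    refine le_max_of_le_right (Nat.succ_le_succ (le_foldr_max ?_))
    have hq := (hp.map bDepth).erase (bDepth t)
    rw [List.map_cons, List.erase_cons_head] at hq
    exact hq.mem_iff.2 (List.mem_map_of_mem hs)

theorem exists_rootLeafPath : ∀ T : RTree, ∃ p, RootLeafPath T p
  | .node [] => ⟨_, .leaf⟩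
  | .node (t :: _) =>
    let ⟨_, hp⟩ := exists_rootLeafPath t
    ⟨_, .step List.mem_cons_self hp⟩

end RTree

theorem fDBK_pos (D : ℕ) : ∀ b k, 1 ≤ fDBK D b k
  | 0, 0 => by simp [fDBK]
  | 0, _ + 1 => by simp [fDBK]
  | _ + 1, 0 => by simp [fDBK]
  | _ + 1, 1 => by simp [fDBK]
  | b + 1, k + 2 => by
    rw [fDBK]; exact (fDBK_pos D (b + 1) (k + 1)).trans (Nat.le_add_right _ _)

namespace RTree

theorem exists_rootLeafPath_of_fDBK_lt_leaves (D : ℕ) : ∀ (T : RTree) (b k : ℕ),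
    maxDegree T ≤ D → bDepth T ≤ b → fDBK D b k < leaves T →
    ∃ p, RootLeafPath T p ∧ k ≤ p.countP fun t => decide (2 ≤ numChildren t)
  | .node [], b, k, _, _, hl => by
    have := fDBK_pos D b k
    rw [leaves] at hl
    omega
  | .node [t], b, k, hD, hb, hl => by
    obtain ⟨p, hp, hk⟩ := exists_rootLeafPath_of_fDBK_lt_leaves D t b k
      ((maxDegree_le_of_mem (by simp)).trans hD)
      (le_trans (by rw [bDepth_node (by simp)]; simp) hb)
      (by rw [leaves_node (by simp)] at hl; simpa using hl)
    exact ⟨_, .step (by simp) hp, hk.trans (by simp [List.countP_cons])⟩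
  | .node (t₁ :: t₂ :: ts), b, k, hD, hb, hl => by
    have extend : ∀ j, (∃ s ∈ t₁ :: t₂ :: ts, ∃ p, RootLeafPath s p ∧
        j ≤ p.countP fun t => decide (2 ≤ numChildren t)) →
        ∃ p, RootLeafPath (.node (t₁ :: t₂ :: ts)) p ∧
          j + 1 ≤ p.countP fun t => decide (2 ≤ numChildren t) := by
      rintro j ⟨s, hs, p, hp, hj⟩
      refine ⟨_, .step hs hp, ?_⟩
      rw [List.countP_cons_of_pos (by simp [numChildren])]
      omega
    have trivial_bound : ∃ p, RootLeafPath (.node (t₁ :: t₂ :: ts)) p ∧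
          1 ≤ p.countP fun t => decide (2 ≤ numChildren t) := by
      obtain ⟨p, hp⟩ := exists_rootLeafPath t₁
      exact extend 0 ⟨t₁, by simp, p, hp, Nat.zero_le _⟩
    match b, k with
    | _, 0 =>
      obtain ⟨p, hp, _⟩ := trivial_bound
      exact ⟨p, hp, Nat.zero_le _⟩
    | _, 1 => exact trivial_bound
    | 0, k + 2 =>
      rw [bDepth_node (by simp)] at hb
      simp at hb
    | b + 1, k + 2 =>
      apply extend (k + 1)
      by_contra hno
      have bound : ∀ s ∈ t₁ :: t₂ :: ts, ∀ c, bDepth s ≤ c →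
          leaves s ≤ fDBK D c (k + 1) := by
        intro s hs c hc
        by_contra! hlt
        exact hno ⟨s, hs, exists_rootLeafPath_of_fDBK_lt_leaves D s c (k + 1)
          ((maxDegree_le_of_mem hs).trans hD) hc hlt⟩
      obtain ⟨t, rest, hperm, ht, hrest⟩ :=
        exists_perm_cons_bDepth (List.cons_ne_nil t₁ (t₂ :: ts))
      have hlen : rest.length + 1 ≤ D := by
        have := hperm.length_eq
        have := length_le_maxDegree (t₁ :: t₂ :: ts)
        simp only [List.length_cons] at *
        omega
      have hsum : (rest.map leaves).sum ≤ rest.length * fDBK D b (k + 1) := by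
        have := List.sum_le_card_nsmul (rest.map leaves) (fDBK D b (k + 1)) (by
          intro n hn
          obtain ⟨s, hs, rfl⟩ := List.mem_map.1 hn
          have := hrest s hs
          exact bound s (hperm.mem_iff.2 (List.mem_cons_of_mem _ hs)) b (by omega))
        simpa using this
      have hmul : rest.length * fDBK D b (k + 1) ≤ (D - 1) * fDBK D b (k + 1) :=
        Nat.mul_le_mul_right _ (by omega)
      have hfirst := bound t (hperm.mem_iff.2 List.mem_cons_self) (b + 1) (ht.trans hb)
      rw [leaves_node (by simp), (hperm.map leaves).sum_eq, fDBK, List.map_cons,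
        List.sum_cons] at hl
      omega
termination_by T => T
decreasing_by
  · simp; omega
  · have := List.sizeOf_lt_of_mem hs
    simp only [RTree.node.sizeOf_spec]
    omega

end RTree


open RTree in
/-- Corollary 3.7 (core): if `T` is a rooted tree of maximum degree at most `D`
with `b(T) ≤ b` and more than `f(D,b,k)` leaves, then `T` contains a
root-to-leaf path on which at least `k` vertices have at least two children. -/
theorem stmt_1 (D b k : ℕ) (hD : 1 ≤ D) (hk : 1 ≤ k) (T : RTree)
    (hdeg : maxDegree T ≤ D) (hb : bDepth T ≤ b)
    (hleaves : fDBK D b k < leaves T) :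
    ∃ p : List RTree, RootLeafPath T p ∧
      k ≤ (p.countP fun t => decide (2 ≤ numChildren t)) := by
  exact exists_rootLeafPath_of_fDBK_lt_leaves D T b k hdeg hb hleaves
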